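/- Let C_ℓ be a lattice cube with edge vectors α=(a₁,b₁,c₁), β=(a₂,b₂,c₂), γ=(a₃,b₃,c₃), pairwise orthogonal of length ℓ, and dᵢ = gcd(aᵢ,bᵢ,cᵢ). Then the coefficient of t in the Ehrhart polynomial of C_ℓ equals d₁+d₂+d₃. -/

import Mathlib

open Pointwise

/-- Number of lattice points of ℤ³ in the dilate `t•C` of the lattice cube (parallelepiped)
with a vertex at the origin and edge vectors `v₁ v₂ v₃`. -/
noncomputable def cubeCount (v₁ v₂ v₃ : Fin 3 → ℤ) (t : ℕ) : ℕ :=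
  Set.ncard {p : Fin 3 → ℤ | ∃ x y z : ℝ, x ∈ Set.Icc (0 : ℝ) t ∧ y ∈ Set.Icc (0 : ℝ) t ∧
    z ∈ Set.Icc (0 : ℝ) t ∧ ∀ k, (p k : ℝ) = x * v₁ k + y * v₂ k + z * v₃ k}

/-- gcd of the three coordinates of an integer vector. -/
def gcd3 (v : Fin 3 → ℤ) : ℕ := Int.gcd (v 0) (Int.gcd (v 1) (v 2))

/-- Dot product of integer vectors in ℤ³. -/
def dot3 (u v : Fin 3 → ℤ) : ℤ := u 0 * v 0 + u 1 * v 1 + u 2 * v 2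

lemma dot3_add (p q v : Fin 3 → ℤ) : dot3 (p + q) v = dot3 p v + dot3 q v := by
  simp only [dot3, Pi.add_apply]; ring

lemma dot3_smul (k : ℤ) (p v : Fin 3 → ℤ) : dot3 (k • p) v = k * dot3 p v := by
  simp only [dot3, Pi.smul_apply, smul_eq_mul]; ring

lemma dot3_comm' (p v : Fin 3 → ℤ) : dot3 p v = dot3 v p := by
  simp only [dot3]; ring

/-- Slicing lemma: counting points in a dilate in the direction of `v`. -/
lemma slice_count (P : (Fin 3 → ℤ) → Prop) (v : Fin 3 → ℤ) (m : ℤ) (hm : 0 < m)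
    (hv : dot3 v v = m) (hP : ∀ p (k : ℤ), P p → P (p + k • v))
    (hfin : ∀ a b : ℤ, {p | P p ∧ a ≤ dot3 p v ∧ dot3 p v ≤ b}.Finite) (t : ℕ) :
    {p | P p ∧ 0 ≤ dot3 p v ∧ dot3 p v ≤ t * m}.ncard =
      t * {p | P p ∧ 0 ≤ dot3 p v ∧ dot3 p v < m}.ncard + {p | P p ∧ dot3 p v = 0}.ncard := by
  have shift : ∀ (a b c d k : ℤ), a + k * m = c → b + k * m = d →
      {p | P p ∧ c < dot3 p v ∧ dot3 p v ≤ d}.ncard =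
      {p | P p ∧ a < dot3 p v ∧ dot3 p v ≤ b}.ncard := by
    intro a b c d k h1 h2
    symm
    apply Set.ncard_congr (fun p _ => p + k • v)
    · rintro p ⟨h, h3, h4⟩
      refine ⟨hP _ _ h, ?_, ?_⟩ <;> rw [dot3_add, dot3_smul, hv] <;> omega
    · intro p q _ _ h; simpa using h
    · rintro p ⟨h, h3, h4⟩
      refine ⟨p + (-k) • v, ⟨hP _ _ h, ?_, ?_⟩, by simp⟩ <;>
        rw [dot3_add, dot3_smul, hv, neg_mul] <;> omega
  have hA : {p | P p ∧ 0 < dot3 p v ∧ dot3 p v ≤ m}.ncard =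
      {p | P p ∧ 0 ≤ dot3 p v ∧ dot3 p v < m}.ncard := by
    have e1 : {p | P p ∧ 0 ≤ dot3 p v ∧ dot3 p v < m} =
        {p | P p ∧ dot3 p v = 0} ∪ {p | P p ∧ 0 < dot3 p v ∧ dot3 p v ≤ m - 1} := by
      ext p; simp only [Set.mem_ofPred_eq, Set.mem_union, ← and_or_left]
      refine and_congr_right fun _ => ?_; omega
    have e2 : {p | P p ∧ 0 < dot3 p v ∧ dot3 p v ≤ m} =
        {p | P p ∧ m - 1 < dot3 p v ∧ dot3 p v ≤ m} ∪
        {p | P p ∧ 0 < dot3 p v ∧ dot3 p v ≤ m - 1} := by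
      ext p; simp only [Set.mem_ofPred_eq, Set.mem_union, ← and_or_left]
      refine and_congr_right fun _ => ?_; omega
    rw [e1, e2, Set.ncard_union_eq ?_ ?_ ?_, Set.ncard_union_eq ?_ ?_ ?_, shift (-1) 0 (m-1) m 1 (by ring) (by ring)]
    · congr 2; ext p; simp only [Set.mem_ofPred_eq]
      refine and_congr_right fun _ => ?_; omega
    · rw [Set.disjoint_left]; rintro p ⟨_, h⟩ ⟨_, h', _⟩; omega
    · exact (hfin 0 0).subset fun p ⟨h, h'⟩ => ⟨h, h'.ge, h'.le⟩
    · exact (hfin 0 (m-1)).subset fun p ⟨h, h', h''⟩ => ⟨h, h'.le, h''⟩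
    · rw [Set.disjoint_left]; rintro p ⟨_, h, _⟩ ⟨_, _, h'⟩; omega
    · exact (hfin (m-1) m).subset fun p ⟨h, h', h''⟩ => ⟨h, h'.le, h''⟩
    · exact (hfin 0 (m-1)).subset fun p ⟨h, h', h''⟩ => ⟨h, h'.le, h''⟩
  induction t with
  | zero =>
    simp only [Nat.cast_zero, zero_mul, zero_add]
    congr 1; ext p; simp only [Set.mem_ofPred_eq]
    refine and_congr_right fun _ => ?_; omega
  | succ t ih =>
    have hpos : 0 ≤ (t:ℤ) * m := by positivity
    have hs : ((t+1 : ℕ):ℤ) * m = t * m + m := by push_cast; ring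
    rw [hs]
    have e : {p | P p ∧ 0 ≤ dot3 p v ∧ dot3 p v ≤ t * m + m} =
        {p | P p ∧ 0 ≤ dot3 p v ∧ dot3 p v ≤ t * m} ∪
        {p | P p ∧ t * m < dot3 p v ∧ dot3 p v ≤ t * m + m} := by
      ext p; simp only [Set.mem_ofPred_eq, Set.mem_union, ← and_or_left]
      refine and_congr_right fun _ => ?_; omega
    rw [e, Set.ncard_union_eq ?_ ?_ ?_, ih, shift 0 m (t*m) (t*m+m) t (by ring) (by ring), hA]
    · ring
    · rw [Set.disjoint_left]; rintro p ⟨_, _, h⟩ ⟨_, h', _⟩; omega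
    · exact hfin _ _
    · exact (hfin (t*m) (t*m+m)).subset fun p ⟨h, h', h''⟩ => ⟨h, h'.le, h''⟩

/-- Orthogonality data. -/
structure OrthCube (m : ℤ) (a b c : Fin 3 → ℤ) : Prop where
  pos : 0 < m
  haa : dot3 a a = m
  hbb : dot3 b b = m
  hcc : dot3 c c = m
  hab : dot3 a b = 0
  hac : dot3 a c = 0
  hbc : dot3 b c = 0

namespace OrthCube
variable {m : ℤ} {a b c : Fin 3 → ℤ}

lemma rot (h : OrthCube m a b c) : OrthCube m b c a :=
  ⟨h.pos, h.hbb, h.hcc, h.haa, h.hbc, by rw [dot3_comm', h.hab], by rw [dot3_comm', h.hac]⟩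

lemma det_sq (h : OrthCube m a b c) : (Matrix.of ![a, b, c]).det ^ 2 = m ^ 3 := by
  have h1 : Matrix.of ![a, b, c] * (Matrix.of ![a, b, c]).transpose =
      Matrix.diagonal (fun _ => m) := by
    obtain ⟨_, h1, h2, h3, h4, h5, h6⟩ := h
    simp only [dot3] at *
    ext i j
    fin_cases i <;> fin_cases j <;>
      simp [Matrix.mul_apply, Fin.sum_univ_three, Matrix.diagonal] <;> linarith
  have h2 := congrArg Matrix.det h1
  rw [Matrix.det_mul, Matrix.det_transpose, Matrix.det_diagonal] at h2
  simp at h2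
  linarith [sq (Matrix.of ![a, b, c]).det]

lemma det_ne (h : OrthCube m a b c) : (Matrix.of ![a, b, c]).det ≠ 0 := by
  intro h0
  have := h.det_sq
  rw [h0] at this
  have := pow_pos h.pos 3
  simp_all

lemma eq_zero (h : OrthCube m a b c) (p : Fin 3 → ℤ) (ha : dot3 p a = 0) (hb : dot3 p b = 0)
    (hc : dot3 p c = 0) : p = 0 := by
  apply Matrix.eq_zero_of_mulVec_eq_zero h.det_ne
  simp only [dot3] at *
  ext i
  fin_cases i <;> simp [Matrix.mulVec, dotProduct, Fin.sum_univ_three] <;> linarith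

lemma recon (h : OrthCube m a b c) (p : Fin 3 → ℤ) :
    m • p = dot3 p a • a + dot3 p b • b + dot3 p c • c := by
  obtain ⟨_, h1, h2, h3, h4, h5, h6⟩ := id h
  have h4' := h4; have h5' := h5; have h6' := h6
  rw [dot3_comm'] at h4' h5' h6'
  rw [← sub_eq_zero, sub_eq_add_neg, ← neg_one_smul ℤ (_ + _)]
  apply h.eq_zero <;> simp only [dot3_add, dot3_smul, h1, h2, h3, h4, h5, h6, h4', h5', h6'] <;>
    ring

lemma inj (h : OrthCube m a b c) :
    Function.Injective (fun p => (dot3 p a, dot3 p b, dot3 p c)) := by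
  intro p q hpq
  simp only [Prod.mk.injEq] at hpq
  obtain ⟨h1, h2, h3⟩ := hpq
  rw [← sub_eq_zero, sub_eq_add_neg, ← neg_one_smul ℤ q]
  apply h.eq_zero <;> rw [dot3_add, dot3_smul] <;> linarith

lemma fin (h : OrthCube m a b c) (S : Set (Fin 3 → ℤ)) (l u : ℤ)
    (hS : ∀ p ∈ S, (l ≤ dot3 p a ∧ dot3 p a ≤ u) ∧ (l ≤ dot3 p b ∧ dot3 p b ≤ u) ∧
      (l ≤ dot3 p c ∧ dot3 p c ≤ u)) : S.Finite := by
  have hf : ((Set.Icc l u) ×ˢ ((Set.Icc l u) ×ˢ (Set.Icc l u))).Finite :=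
    (Set.finite_Icc l u).prod ((Set.finite_Icc l u).prod (Set.finite_Icc l u))
  exact (hf.preimage h.inj.injOn).subset fun p hp => hS p hp

end OrthCube

/-- Slicing lemma for an orthogonal cube, with the other two coordinates in bounded sets. -/
lemma OrthCube.slice {m : ℤ} {a b c : Fin 3 → ℤ} (h : OrthCube m a b c) (Q R : ℤ → Prop)
    (u : ℤ) (hQ : ∀ x, Q x → 0 ≤ x ∧ x ≤ u) (hR : ∀ x, R x → 0 ≤ x ∧ x ≤ u) (t : ℕ) :
    {p | (Q (dot3 p b) ∧ R (dot3 p c)) ∧ 0 ≤ dot3 p a ∧ dot3 p a ≤ t * m}.ncard =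
      t * {p | (Q (dot3 p b) ∧ R (dot3 p c)) ∧ 0 ≤ dot3 p a ∧ dot3 p a < m}.ncard +
        {p | (Q (dot3 p b) ∧ R (dot3 p c)) ∧ dot3 p a = 0}.ncard := by
  apply slice_count (fun p => Q (dot3 p b) ∧ R (dot3 p c)) a m h.pos h.haa
  · intro p k hp
    simpa only [dot3_add, dot3_smul, h.hab, h.hac, mul_zero, add_zero] using hp
  · intro l r
    apply h.fin _ (min l 0) (max r u)
    rintro p ⟨⟨h1, h2⟩, h3, h4⟩
    have := hQ _ h1
    have := hR _ h2
    omega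

/-- The edge count. -/
lemma OrthCube.edge {m : ℤ} {a b c : Fin 3 → ℤ} (h : OrthCube m a b c) :
    {p | (dot3 p b = 0 ∧ dot3 p c = 0) ∧ 0 ≤ dot3 p a ∧ dot3 p a < m}.ncard = gcd3 a := by
  set d : ℤ := (gcd3 a : ℤ) with hd
  have hd0 : d = Int.gcd (a 0) (Int.gcd (a 1) (a 2)) := rfl
  have d0 : d ∣ a 0 := by rw [hd0]; exact Int.gcd_dvd_left ..
  have d12 : d ∣ (Int.gcd (a 1) (a 2) : ℤ) := by rw [hd0]; exact Int.gcd_dvd_right ..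
  have d1 : d ∣ a 1 := d12.trans (Int.gcd_dvd_left ..)
  have d2 : d ∣ a 2 := d12.trans (Int.gcd_dvd_right ..)
  obtain ⟨u, hu⟩ : ∃ u : Fin 3 → ℤ, dot3 a u = d := by
    have e1 := Int.gcd_eq_gcd_ab (a 0) (Int.gcd (a 1) (a 2))
    have e2 := Int.gcd_eq_gcd_ab (a 1) (a 2)
    rw [← hd0] at e1
    refine ⟨![Int.gcdA (a 0) (Int.gcd (a 1) (a 2)),
      Int.gcdA (a 1) (a 2) * Int.gcdB (a 0) (Int.gcd (a 1) (a 2)),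
      Int.gcdB (a 1) (a 2) * Int.gcdB (a 0) (Int.gcd (a 1) (a 2))], ?_⟩
    generalize Int.gcdB (a 0) (Int.gcd (a 1) (a 2)) = y at *
    rw [e1]
    simp only [dot3]
    simp only [Matrix.cons_val]
    linear_combination (-y) * e2
  obtain ⟨w, hw⟩ : ∃ w : Fin 3 → ℤ, a = d • w := by
    obtain ⟨x, hx⟩ := d0
    obtain ⟨y, hy⟩ := d1
    obtain ⟨z, hz⟩ := d2
    refine ⟨![x, y, z], ?_⟩
    ext i; fin_cases i <;> simp [hx, hy, hz]
  have hm := h.pos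
  have hdn : 0 ≤ d := by positivity
  have hdne : d ≠ 0 := by
    intro h0
    have := h.haa
    rw [hw, h0, dot3_smul, zero_mul] at this
    omega
  have hdpos : 0 < d := by omega
  have hwu : dot3 w u = 1 := by
    have := hu
    rw [hw, dot3_smul] at this
    exact mul_left_cancel₀ hdne (by rw [this, mul_one])
  have hwa : d * dot3 w a = m := by rw [← dot3_smul, ← hw, h.haa]
  have hwb : dot3 w b = 0 := by
    have := h.hab
    rw [hw, dot3_smul] at this
    simpa [hdne] using this
  have hwc : dot3 w c = 0 := by
    have := h.hac
    rw [hw, dot3_smul] at this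
    simpa [hdne] using this
  have hwpos : 0 < dot3 w a := by
    by_contra hc
    nlinarith
  have hset : {p | (dot3 p b = 0 ∧ dot3 p c = 0) ∧ 0 ≤ dot3 p a ∧ dot3 p a < m} =
      (fun k : ℤ => k • w) '' (Set.Ico 0 d) := by
    ext p
    simp only [Set.mem_ofPred_eq, Set.mem_image, Set.mem_Ico]
    constructor
    · rintro ⟨⟨hb, hc⟩, h1, h2⟩
      have hr := h.recon p
      rw [hb, hc, zero_smul, zero_smul, add_zero, add_zero] at hr
      have hru := congrArg (fun q => dot3 q u) hr
      simp only [dot3_smul, hu] at hru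
      have hp : dot3 p u • w = p := by
        apply smul_right_injective _ hm.ne'
        change m • (dot3 p u • w) = m • p
        rw [hr, smul_smul, hru, ← smul_smul, ← hw]
      refine ⟨dot3 p u, ?_, hp⟩
      constructor
      · by_contra hc
        nlinarith
      · by_contra hc
        nlinarith
    · rintro ⟨k, ⟨h1, h2⟩, rfl⟩
      simp only [dot3_smul, hwb, hwc, mul_zero, true_and]
      refine ⟨by positivity, ?_⟩
      rw [← hwa]
      exact mul_lt_mul_of_pos_right h2 hwpos
  rw [hset, Set.ncard_image_of_injective, ← Nat.card_coe_set_eq]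
  · simp [hd]
  · intro x y hxy
    have := congrArg (fun q => dot3 q u) hxy
    simpa only [dot3_smul, hwu, mul_one] using this

set_option linter.unusedSimpArgs false in
/-- The half-open cube count. -/
lemma OrthCube.vol {m : ℤ} {a b c : Fin 3 → ℤ} (h : OrthCube m a b c) :
    {p | ((0 ≤ dot3 p b ∧ dot3 p b < m) ∧ (0 ≤ dot3 p c ∧ dot3 p c < m)) ∧
      0 ≤ dot3 p a ∧ dot3 p a < m}.ncard = (Matrix.of ![a, b, c]).det.natAbs := by
  let f : (Fin 3 → ℤ) →ₗ[ℤ] (Fin 3 → ℤ) := Matrix.toLin' (Matrix.of ![a, b, c]).transpose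
  have hf : ∀ x, f x = x 0 • a + x 1 • b + x 2 • c := by
    intro x
    ext i
    simp [f, Matrix.mulVec, dotProduct, Fin.sum_univ_three]
    ring
  obtain ⟨hm, h1, h2, h3, h4, h5, h6⟩ := id h
  have h4' := h4; have h5' := h5; have h6' := h6
  rw [dot3_comm'] at h4' h5' h6'
  have hfa : ∀ x, dot3 (f x) a = x 0 * m := by
    intro x; rw [hf]; simp only [dot3_add, dot3_smul, h1, h2, h3, h4, h5, h6, h4', h5', h6']; ring
  have hfb : ∀ x, dot3 (f x) b = x 1 * m := by
    intro x; rw [hf]; simp only [dot3_add, dot3_smul, h1, h2, h3, h4, h5, h6, h4', h5', h6']; ring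
  have hfc : ∀ x, dot3 (f x) c = x 2 * m := by
    intro x; rw [hf]; simp only [dot3_add, dot3_smul, h1, h2, h3, h4, h5, h6, h4', h5', h6']; ring
  have hinj : Function.Injective f := by
    intro x y hxy
    have ea := congrArg (fun q => dot3 q a) hxy
    have eb := congrArg (fun q => dot3 q b) hxy
    have ec := congrArg (fun q => dot3 q c) hxy
    simp only [hfa, hfb, hfc] at ea eb ec
    ext i
    fin_cases i
    · exact mul_right_cancel₀ hm.ne' ea
    · exact mul_right_cancel₀ hm.ne' eb
    · exact mul_right_cancel₀ hm.ne' ec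
  have hcard := Submodule.natAbs_det_equiv (LinearMap.range f) (LinearEquiv.ofInjective f hinj)
  have hdet : LinearMap.det f = (Matrix.of ![a, b, c]).det := by
    rw [LinearMap.det_toLin', Matrix.det_transpose]
  have hcomp : ((LinearMap.range f).subtype ∘ₗ AddMonoidHom.toIntLinearMap
      ((LinearEquiv.ofInjective f hinj : (Fin 3 → ℤ) ≃ₗ[ℤ] LinearMap.range f) :
        (Fin 3 → ℤ) →+ LinearMap.range f)) = f := by
    ext x; rfl
  rw [hcomp, hdet] at hcard
  rw [hcard, ← Nat.card_coe_set_eq]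
  apply Nat.card_eq_of_bijective
    (fun p : ({p | ((0 ≤ dot3 p b ∧ dot3 p b < m) ∧ (0 ≤ dot3 p c ∧ dot3 p c < m)) ∧
      0 ≤ dot3 p a ∧ dot3 p a < m} : Set (Fin 3 → ℤ)) =>
        (LinearMap.range f).mkQ (p : Fin 3 → ℤ))
  have key : ∀ x y k : ℤ, 0 ≤ x → x < m → 0 ≤ y → y < m → k * m = x - y → x = y := by
    intro x y k hx hx' hy hy' hk
    have : k = 0 := by
      have : k < 1 := by by_contra hc; nlinarith
      have : -1 < k := by by_contra hc; nlinarith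
      omega
    subst this
    linarith
  constructor
  · rintro ⟨p, ⟨⟨pb, pb'⟩, pc, pc'⟩, pa, pa'⟩ ⟨q, ⟨⟨qb, qb'⟩, qc, qc'⟩, qa, qa'⟩ hpq
    simp only [Submodule.mkQ_apply] at hpq
    rw [Submodule.Quotient.eq] at hpq
    obtain ⟨x, hx⟩ := hpq
    have hx' : f x = p + (-1 : ℤ) • q := by rw [hx]; simp [sub_eq_add_neg]
    have ea := congrArg (fun q => dot3 q a) hx'
    have eb := congrArg (fun q => dot3 q b) hx'
    have ec := congrArg (fun q => dot3 q c) hx'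
    simp only [hfa, hfb, hfc, dot3_add, dot3_smul] at ea eb ec
    apply Subtype.ext
    apply h.inj
    simp only [Prod.mk.injEq]
    exact ⟨key _ _ (x 0) pa pa' qa qa' (by linarith), key _ _ (x 1) pb pb' qb qb' (by linarith),
      key _ _ (x 2) pc pc' qc qc' (by linarith)⟩
  · intro y
    obtain ⟨p, rfl⟩ := Submodule.mkQ_surjective _ y
    let x : Fin 3 → ℤ := ![-(dot3 p a / m), -(dot3 p b / m), -(dot3 p c / m)]
    have ha : dot3 (p + f x) a = dot3 p a % m := by
      rw [dot3_add, hfa, Int.emod_def]; simp [x]; ring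
    have hb : dot3 (p + f x) b = dot3 p b % m := by
      rw [dot3_add, hfb, Int.emod_def]; simp [x]; ring
    have hc : dot3 (p + f x) c = dot3 p c % m := by
      rw [dot3_add, hfc, Int.emod_def]; simp [x]; ring
    refine ⟨⟨p + f x, ?_⟩, ?_⟩
    · simp only [Set.mem_ofPred_eq, ha, hb, hc]
      have e := fun z : ℤ => Int.emod_nonneg z hm.ne'
      have e' := fun z : ℤ => Int.emod_lt_of_pos z hm
      exact ⟨⟨⟨e _, e' _⟩, e _, e' _⟩, e _, e' _⟩
    · simp only [Submodule.mkQ_apply]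
      rw [Submodule.Quotient.eq]
      exact ⟨x, by simp⟩

lemma OrthCube.cubeCount_eq {m : ℤ} {a b c : Fin 3 → ℤ} (h : OrthCube m a b c) (t : ℕ) :
    cubeCount a b c t = {p | ((0 ≤ dot3 p b ∧ dot3 p b ≤ t * m) ∧
      (0 ≤ dot3 p c ∧ dot3 p c ≤ t * m)) ∧ 0 ≤ dot3 p a ∧ dot3 p a ≤ t * m}.ncard := by
  unfold cubeCount
  congr 1
  ext p
  simp only [Set.mem_ofPred_eq, Set.mem_Icc]
  have hm : (0:ℝ) < m := by exact_mod_cast h.pos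
  have hcast : ∀ u v : Fin 3 → ℤ, ((dot3 u v : ℤ) : ℝ) = u 0 * v 0 + u 1 * v 1 + u 2 * v 2 := by
    intro u v; simp [dot3]
  constructor
  · rintro ⟨x, y, z, ⟨hx, hx'⟩, ⟨hy, hy'⟩, ⟨hz, hz'⟩, hp⟩
    have haa : ((dot3 a a : ℤ) : ℝ) = m := by rw [h.haa]
    have hbb : ((dot3 b b : ℤ) : ℝ) = m := by rw [h.hbb]
    have hcc : ((dot3 c c : ℤ) : ℝ) = m := by rw [h.hcc]
    have hab : ((dot3 a b : ℤ) : ℝ) = 0 := by rw [h.hab]; simp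
    have hac : ((dot3 a c : ℤ) : ℝ) = 0 := by rw [h.hac]; simp
    have hbc : ((dot3 b c : ℤ) : ℝ) = 0 := by rw [h.hbc]; simp
    rw [hcast] at haa hbb hcc hab hac hbc
    have ea : ((dot3 p a : ℤ) : ℝ) = x * m := by
      rw [hcast, hp, hp, hp]; linear_combination x * haa + y * hab + z * hac
    have eb : ((dot3 p b : ℤ) : ℝ) = y * m := by
      rw [hcast, hp, hp, hp]; linear_combination x * hab + y * hbb + z * hbc
    have ec : ((dot3 p c : ℤ) : ℝ) = z * m := by
      rw [hcast, hp, hp, hp]; linear_combination x * hac + y * hbc + z * hcc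
    have key : ∀ (n : ℤ) (s : ℝ), (n : ℝ) = s * m → 0 ≤ s → s ≤ t → 0 ≤ n ∧ n ≤ t * m := by
      intro n s hn hs hs'
      constructor
      · have : (0:ℝ) ≤ n := by rw [hn]; positivity
        exact_mod_cast this
      · have : (n:ℝ) ≤ t * m := by rw [hn]; gcongr
        exact_mod_cast this
    exact ⟨⟨key _ _ eb hy hy', key _ _ ec hz hz'⟩, key _ _ ea hx hx'⟩
  · rintro ⟨⟨hb, hc⟩, ha⟩
    have key : ∀ n : ℤ, 0 ≤ n ∧ n ≤ t * m → 0 ≤ (n:ℝ) / m ∧ (n:ℝ) / m ≤ t := by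
      rintro n ⟨h1, h2⟩
      have h1' : (0:ℝ) ≤ n := by exact_mod_cast h1
      have h2' : (n:ℝ) ≤ t * m := by exact_mod_cast h2
      exact ⟨by positivity, by rwa [div_le_iff₀ hm]⟩
    refine ⟨_, _, _, key _ ha, key _ hb, key _ hc, fun k => ?_⟩
    have := congrFun (h.recon p) k
    simp only [Pi.smul_apply, Pi.add_apply, smul_eq_mul] at this
    have this' : (m:ℝ) * p k = dot3 p a * a k + dot3 p b * b k + dot3 p c * c k := by
      exact_mod_cast this
    field_simp
    linarith

/-- The polynomial expansion of the count. -/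
lemma OrthCube.poly {m : ℤ} {a b c : Fin 3 → ℤ} (h : OrthCube m a b c) :
    ∃ F : ℕ, ∀ t : ℕ, cubeCount a b c t = (Matrix.of ![a, b, c]).det.natAbs * t ^ 3 + F * t ^ 2 +
      (gcd3 a + gcd3 b + gcd3 c) * t + 1 := by
  have hm := h.pos
  let I : ℕ → ℤ → Prop := fun t x => 0 ≤ x ∧ x ≤ t * m
  let J : ℤ → Prop := fun x => 0 ≤ x ∧ x < m
  let Z : ℤ → Prop := fun x => x = 0
  let N : (ℤ → Prop) → (ℤ → Prop) → (ℤ → Prop) → ℕ := fun P Q R =>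
    {p | P (dot3 p a) ∧ Q (dot3 p b) ∧ R (dot3 p c)}.ncard
  have bI : ∀ t x, I t x → 0 ≤ x ∧ x ≤ t * m + m := fun t x hx => ⟨hx.1, by have := hx.2; omega⟩
  have bJ : ∀ t : ℕ, ∀ x, J x → 0 ≤ x ∧ x ≤ t * m + m := fun t x hx =>
    ⟨hx.1, by have := hx.2; have : 0 ≤ t * m := by positivity
              omega⟩
  have bZ : ∀ t : ℕ, ∀ x, Z x → 0 ≤ x ∧ x ≤ t * m + m := fun t x hx =>
    ⟨hx.ge, by have : x = 0 := hx
               rw [this]; positivity⟩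
  have sa : ∀ (t : ℕ) (Q R : ℤ → Prop), (∀ x, Q x → 0 ≤ x ∧ x ≤ t * m + m) →
      (∀ x, R x → 0 ≤ x ∧ x ≤ t * m + m) → N (I t) Q R = t * N J Q R + N Z Q R := by
    intro t Q R hQ hR
    have := h.slice Q R (t * m + m) hQ hR t
    simpa only [N, I, J, Z, and_comm, and_assoc, and_left_comm] using this
  have sb : ∀ (t : ℕ) (P R : ℤ → Prop), (∀ x, P x → 0 ≤ x ∧ x ≤ t * m + m) →
      (∀ x, R x → 0 ≤ x ∧ x ≤ t * m + m) → N P (I t) R = t * N P J R + N P Z R := by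
    intro t P R hP hR
    have := h.rot.slice R P (t * m + m) hR hP t
    simpa only [N, I, J, Z, and_comm, and_assoc, and_left_comm] using this
  have sc : ∀ (t : ℕ) (P Q : ℤ → Prop), (∀ x, P x → 0 ≤ x ∧ x ≤ t * m + m) →
      (∀ x, Q x → 0 ≤ x ∧ x ≤ t * m + m) → N P Q (I t) = t * N P Q J + N P Q Z := by
    intro t P Q hP hQ
    have := h.rot.rot.slice P Q (t * m + m) hP hQ t
    simpa only [N, I, J, Z, and_comm, and_assoc, and_left_comm] using this
  have ea : N J Z Z = gcd3 a := by
    have := h.edge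
    simpa only [N, I, J, Z, and_comm, and_assoc, and_left_comm] using this
  have eb : N Z J Z = gcd3 b := by
    have := h.rot.edge
    simpa only [N, I, J, Z, and_comm, and_assoc, and_left_comm] using this
  have ec : N Z Z J = gcd3 c := by
    have := h.rot.rot.edge
    simpa only [N, I, J, Z, and_comm, and_assoc, and_left_comm] using this
  have ev : N J J J = (Matrix.of ![a, b, c]).det.natAbs := by
    have := h.vol
    simpa only [N, I, J, Z, and_comm, and_assoc, and_left_comm] using this
  have e0 : N Z Z Z = 1 := by
    simp only [N, Z]
    rw [Set.ncard_eq_one]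
    refine ⟨0, ?_⟩
    ext p
    simp only [Set.mem_ofPred_eq, Set.mem_singleton_iff]
    constructor
    · rintro ⟨h1, h2, h3⟩; exact h.eq_zero p h1 h2 h3
    · rintro rfl; simp [dot3]
  refine ⟨N J J Z + N J Z J + N Z J J, fun t => ?_⟩
  have e : cubeCount a b c t = N (I t) (I t) (I t) := by
    rw [h.cubeCount_eq t]
    simp only [N, I, and_comm, and_left_comm]
  rw [e, sa t _ _ (bI t) (bI t), sb t J _ (bJ t) (bI t), sb t Z _ (bZ t) (bI t),
    sc t J J (bJ t) (bJ t), sc t J Z (bJ t) (bZ t), sc t Z J (bZ t) (bJ t),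
    sc t Z Z (bZ t) (bZ t), ev, ea, eb, ec, e0]
  ring

theorem cube_ehrhart_linear_coeff (ℓ : ℤ) (hℓ : 0 < ℓ) (v₁ v₂ v₃ : Fin 3 → ℤ)
    (h11 : dot3 v₁ v₁ = ℓ ^ 2) (h22 : dot3 v₂ v₂ = ℓ ^ 2) (h33 : dot3 v₃ v₃ = ℓ ^ 2)
    (h12 : dot3 v₁ v₂ = 0) (h13 : dot3 v₁ v₃ = 0) (h23 : dot3 v₂ v₃ = 0) :
    ∃ lam₁ : ℚ, ∀ t : ℕ, 0 < t →
      (cubeCount v₁ v₂ v₃ t : ℚ) =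
        (ℓ : ℚ) ^ 3 * t ^ 3 + lam₁ * t ^ 2
          + ((gcd3 v₁ : ℚ) + gcd3 v₂ + gcd3 v₃) * t + 1 := by
  have h : OrthCube (ℓ ^ 2) v₁ v₂ v₃ := ⟨by positivity, h11, h22, h33, h12, h13, h23⟩
  have hdet : ((Matrix.of ![v₁, v₂, v₃]).det.natAbs : ℤ) = ℓ ^ 3 := by
    have h1 := h.det_sq
    rw [Int.natCast_natAbs]
    have h2 : |(Matrix.of ![v₁, v₂, v₃]).det| = |ℓ ^ 3| := by
      rw [← sq_eq_sq_iff_abs_eq_abs, h1]; ring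
    rw [h2, abs_of_pos (by positivity)]
  have hdet' : ((Matrix.of ![v₁, v₂, v₃]).det.natAbs : ℚ) = (ℓ : ℚ) ^ 3 := by
    rw [← Int.cast_natCast, hdet, Int.cast_pow]
  obtain ⟨F, hF⟩ := h.poly
  refine ⟨F, fun t _ => ?_⟩
  rw [hF t]
  push_cast only [Nat.cast_add, Nat.cast_mul, Nat.cast_pow, Nat.cast_one]
  rw [hdet']
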